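/- Let {x_k}, {y_k}, {z_k} be sequences generated by Nesterov's accelerated mirror descent: z_{k+1} = z_k − ((k+1)σs/2)∇f(x_k); y_{k+1} = argmin_{y ∈ C} { s⟨∇f(x_k), y⟩ + (1/2)‖y − x_k‖² }; x_{k+1} = ((k+1)/(k+3)) y_{k+1} + (2/(k+3)) ∇φ*(z_{k+1}), with x₀ = y₀ = ∇φ*(z₀). If 0 < s < 1/L, then min_{0 ≤ i ≤ k} ‖y_{i+1} − x_i‖² = o(1/k³) as k → ∞; that is, k³ · min_{0 ≤ i ≤ k} ‖y_{i+1} − x_i‖² → 0. -/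

import Mathlib

open Set Filter Topology
open scoped RealInnerProductSpace

/-- The Fenchel conjugate of a function over a constraint set `C`. -/
noncomputable def fenchelConjOn {n : ℕ} (C : Set (EuclideanSpace ℝ (Fin n)))
    (φ : EuclideanSpace ℝ (Fin n) → ℝ) (z : EuclideanSpace ℝ (Fin n)) : ℝ :=
  ⨆ x : C, (⟪z, (x : EuclideanSpace ℝ (Fin n))⟫ - φ x)

/-- A convex function on a nonempty convex set in finite dimension is bounded below by an affine
function of the norm. -/
theorem ConvexOn.exists_neg_mul_one_add_norm_le {V : Type*} [NormedAddCommGroup V]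
    [NormedSpace ℝ V] [FiniteDimensional ℝ V] {C : Set V} {g : V → ℝ}
    (hg : ConvexOn ℝ C g) (hne : C.Nonempty) :
    ∃ K, ∀ x ∈ C, -(K * (1 + ‖x‖)) ≤ g x := by
  obtain ⟨c, c', hc', rfl⟩ := hne.intrinsicInterior hg.1
  have : Nonempty (affineSpan ℝ C) := ⟨c'⟩
  let j : (affineSpan ℝ C).direction →ᵃ[ℝ] V :=
    (affineSpan ℝ C).direction.subtype.toAffineMap + AffineMap.const ℝ _ (c' : V)
  have hj : ∀ v, j v = (v : V) + c' := fun v => rfl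
  have hconv : ConvexOn ℝ (j ⁻¹' C) (g ∘ j) := hg.comp_affineMap j
  have h0 : j ⁻¹' C ∈ 𝓝 (0 : (affineSpan ℝ C).direction) := by
    have hcont : Continuous fun v : (affineSpan ℝ C).direction => v +ᵥ c' := by fun_prop
    have hmem : ((↑) ⁻¹' C : Set (affineSpan ℝ C)) ∈
        𝓝 ((0 : (affineSpan ℝ C).direction) +ᵥ c') := by
      rw [zero_vadd]
      exact mem_interior_iff_mem_nhds.1 hc'
    exact hcont.continuousAt hmem
  have hcts := hconv.continuousOn_interior.continuousAt (interior_mem_nhds.2 h0)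
  have hg0 : (g ∘ j) 0 = g c' := by simp [hj]
  have hev : ∀ᶠ v in 𝓝 0, (g ∘ j) v < g c' + 1 ∧ v ∈ j ⁻¹' C :=
    (hcts.eventually (gt_mem_nhds (hg0 ▸ lt_add_one _))).and h0
  obtain ⟨r, hr, hball⟩ := Metric.eventually_nhds_iff.1 hev
  refine ⟨|g c'| + 2 * (1 + ‖(c' : V)‖) / r, fun x hx => ?_⟩
  have hv : x - c' ∈ (affineSpan ℝ C).direction :=
    AffineSubspace.vsub_mem_direction (subset_affineSpan ℝ C hx) c'.2
  set v : (affineSpan ℝ C).direction := ⟨x - c', hv⟩ with hvdef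
  have hjv : j v = x := by simp [hj, hvdef]
  have hvn : ‖v‖ ≤ ‖x‖ + ‖(c' : V)‖ := norm_sub_le x c'
  have hv0 := norm_nonneg v
  set δ := r / (2 * (1 + ‖v‖)) with hδ
  have hδ0 : 0 < δ := by positivity
  have hδr : δ * (1 + ‖v‖) = r / 2 := by rw [hδ]; field_simp
  obtain ⟨hb1, hb2⟩ := @hball (-(δ • v)) (by
    rw [dist_zero_right, norm_neg, norm_smul, Real.norm_of_nonneg hδ0.le]
    nlinarith)
  have key := hconv.2 (show v ∈ j ⁻¹' C by simpa [hjv] using hx) hb2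
    (by positivity : 0 ≤ δ / (1 + δ)) (by positivity : 0 ≤ 1 / (1 + δ))
    (by rw [← add_div, add_comm, div_self (by positivity)])
  have hz : (δ / (1 + δ)) • v + (1 / (1 + δ)) • (-(δ • v)) = 0 := by
    rw [smul_neg, smul_smul, ← sub_eq_add_neg, ← sub_smul]
    rw [show δ / (1 + δ) - 1 / (1 + δ) * δ = 0 by ring, zero_smul]
  rw [hz, hg0] at key
  have h1 : (g ∘ j) v = g x := by simp [hjv]
  rw [h1, smul_eq_mul, smul_eq_mul] at key
  have key2 : g c' ≤ (δ * g x + (g c' + 1)) / (1 + δ) := by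
    refine key.trans ?_
    have : 1 / (1 + δ) * (g ∘ j) (-(δ • v)) ≤ 1 / (1 + δ) * (g c' + 1) := by gcongr
    calc _ ≤ δ / (1 + δ) * g x + 1 / (1 + δ) * (g c' + 1) := by gcongr
      _ = _ := by ring
  rw [le_div_iff₀ (by positivity)] at key2
  have key3 : g c' - 1 / δ ≤ g x := by
    rw [sub_le_iff_le_add, ← sub_le_iff_le_add', le_div_iff₀ hδ0]
    linarith
  have h2 : 1 / δ = 2 * (1 + ‖v‖) / r := by rw [hδ]; field_simp
  have h3 : 2 * (1 + ‖v‖) / r ≤ 2 * (1 + ‖(c' : V)‖) / r * (1 + ‖x‖) := by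
    rw [div_mul_eq_mul_div]
    refine div_le_div_of_nonneg_right ?_ hr.le
    nlinarith [norm_nonneg x, norm_nonneg (c' : V),
      mul_nonneg (norm_nonneg x) (norm_nonneg (c' : V))]
  have h4 : -(|g c'| * (1 + ‖x‖)) ≤ g c' := by
    nlinarith [neg_abs_le (g c'), abs_nonneg (g c'), norm_nonneg x,
      mul_nonneg (abs_nonneg (g c')) (norm_nonneg x)]
  rw [h2] at key3
  linarith

section FenchelConjugate

variable {n : ℕ} {C : Set (EuclideanSpace ℝ (Fin n))} {φ : EuclideanSpace ℝ (Fin n) → ℝ} {σ : ℝ}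

theorem StrongConvexOn.bddAbove_inner_sub (hφ : StrongConvexOn C σ φ) (hσ : 0 < σ)
    (z : EuclideanSpace ℝ (Fin n)) :
    BddAbove (range fun x : C => ⟪z, (x : EuclideanSpace ℝ (Fin n))⟫ - φ x) := by
  rcases C.eq_empty_or_nonempty with rfl | hne
  · simp
  obtain ⟨K, hK⟩ := (strongConvexOn_iff_convex.1 hφ).exists_neg_mul_one_add_norm_le hne
  refine ⟨K + (‖z‖ + K) ^ 2 / (2 * σ), ?_⟩
  rintro _ ⟨⟨x, hx⟩, rfl⟩
  have h1 := hK x hx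
  have h2 := real_inner_le_norm z x
  have h3 : (‖z‖ + K) * ‖x‖ - σ / 2 * ‖x‖ ^ 2 ≤ (‖z‖ + K) ^ 2 / (2 * σ) := by
    rw [le_div_iff₀ (by positivity)]
    nlinarith [sq_nonneg (‖z‖ + K - σ * ‖x‖)]
  dsimp only
  linarith

theorem inner_sub_le_fenchelConjOn (hφ : StrongConvexOn C σ φ) (hσ : 0 < σ)
    (z : EuclideanSpace ℝ (Fin n)) {x : EuclideanSpace ℝ (Fin n)} (hx : x ∈ C) :
    ⟪z, x⟫ - φ x ≤ fenchelConjOn C φ z :=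
  le_ciSup (hφ.bddAbove_inner_sub hσ z) (⟨x, hx⟩ : C)

/-- Near maximizers in the definition of the conjugate are close to its gradient. -/
theorem exists_norm_sub_le_of_fenchelConjOn_sub_lt (hφ : StrongConvexOn C σ φ) (hσ : 0 < σ)
    {a p : EuclideanSpace ℝ (Fin n)} (hp : HasGradientAt (fenchelConjOn C φ) p a)
    {ε : ℝ} (hε : 0 < ε) :
    ∃ δ > 0, ∀ x ∈ C, fenchelConjOn C φ a - δ < ⟪a, x⟫ - φ x → ‖x - p‖ ≤ ε := by
  have ho := (hasGradientAt_iff_isLittleO.1 hp).def (half_pos hε)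
  obtain ⟨r, hr, hball⟩ := Metric.eventually_nhds_iff.1 ho
  refine ⟨ε / 2 * (r / 2), by positivity, fun x hx hlt => ?_⟩
  by_contra! hcon
  have hpos : 0 < ‖x - p‖ := hε.trans hcon
  set h := (r / 2 / ‖x - p‖) • (x - p) with hh
  have hn : ‖h‖ = r / 2 := by
    rw [hh, norm_smul, Real.norm_of_nonneg (by positivity)]
    field_simp
  have h1 := @hball (a + h) (by simp [hn]; linarith)
  rw [add_sub_cancel_left, hn, Real.norm_eq_abs] at h1
  have h2 := (abs_le.1 h1).2
  have h3 := inner_sub_le_fenchelConjOn hφ hσ (a + h) hx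
  have h4 : ⟪h, x⟫ - ⟪p, h⟫ = r / 2 * ‖x - p‖ := by
    rw [real_inner_comm h p, ← inner_sub_right, hh, real_inner_smul_left,
      real_inner_self_eq_norm_sq]
    field_simp
  rw [inner_add_left] at h3
  nlinarith

/-- There is a maximizing sequence for the conjugate which converges to its gradient. -/
theorem exists_tendsto_fenchelConjOn (hne : C.Nonempty) (hφ : StrongConvexOn C σ φ) (hσ : 0 < σ)
    {a p : EuclideanSpace ℝ (Fin n)} (hp : HasGradientAt (fenchelConjOn C φ) p a) :
    ∃ u : ℕ → EuclideanSpace ℝ (Fin n), (∀ k, u k ∈ C) ∧ Tendsto u atTop (𝓝 p) ∧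
      Tendsto (fun k => ⟪a, u k⟫ - φ (u k)) atTop (𝓝 (fenchelConjOn C φ a)) := by
  have := hne.coe_sort
  have hex : ∀ k : ℕ, ∃ x : C, fenchelConjOn C φ a - 1 / ((k : ℝ) + 1) <
      ⟪a, (x : EuclideanSpace ℝ (Fin n))⟫ - φ x := fun k =>
    exists_lt_of_lt_ciSup (sub_lt_self _ (by positivity))
  choose u hu using hex
  refine ⟨fun k => u k, fun k => (u k).2, ?_, ?_⟩
  · rw [Metric.tendsto_nhds]
    intro ε hε
    obtain ⟨δ, hδ, h⟩ := exists_norm_sub_le_of_fenchelConjOn_sub_lt hφ hσ hp (half_pos hε)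
    filter_upwards [tendsto_one_div_add_atTop_nhds_zero_nat.eventually (gt_mem_nhds hδ)] with k hk
    rw [dist_eq_norm]
    exact (h _ (u k).2 (lt_trans (by linarith) (hu k))).trans_lt (half_lt_self hε)
  · refine tendsto_of_tendsto_of_tendsto_of_le_of_le ?_ tendsto_const_nhds
      (fun k => (hu k).le) (fun k => inner_sub_le_fenchelConjOn hφ hσ a (u k).2)
    simpa using (tendsto_const_nhds (x := fenchelConjOn C φ a)).sub
      (tendsto_one_div_add_atTop_nhds_zero_nat (𝕜 := ℝ))

/-- Quadratic growth: the Fenchel–Young inequality improves by the squared distance to the gradient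
of the conjugate. -/
theorem inner_sub_add_norm_sq_le_fenchelConjOn (hφ : StrongConvexOn C σ φ) (hσ : 0 < σ)
    {a p x : EuclideanSpace ℝ (Fin n)} (hp : HasGradientAt (fenchelConjOn C φ) p a) (hx : x ∈ C) :
    ⟪a, x⟫ - φ x + σ / 2 * ‖x - p‖ ^ 2 ≤ fenchelConjOn C φ a := by
  obtain ⟨u, huC, hup, hua⟩ := exists_tendsto_fenchelConjOn ⟨x, hx⟩ hφ hσ hp
  set M := fenchelConjOn C φ a
  have key : ∀ t : ℝ, 0 < t → t < 1 →
      ⟪a, x⟫ - φ x + σ / 2 * (1 - t) * ‖x - p‖ ^ 2 ≤ M := by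
    intro t ht ht1
    have hk : ∀ k, (1 - t) * (⟪a, u k⟫ - φ (u k)) + t * (⟪a, x⟫ - φ x) +
        t * (1 - t) * (σ / 2 * ‖x - u k‖ ^ 2) ≤ M := by
      intro k
      have h1 := hφ.2 hx (huC k) ht.le (sub_nonneg.2 ht1.le) (by ring)
      have h2 := inner_sub_le_fenchelConjOn hφ hσ a
        (hφ.1 hx (huC k) ht.le (sub_nonneg.2 ht1.le) (by ring))
      rw [inner_add_right, real_inner_smul_right, real_inner_smul_right] at h2
      simp only [smul_eq_mul] at h1
      linarith
    have hlim : Tendsto (fun k => (1 - t) * (⟪a, u k⟫ - φ (u k)) + t * (⟪a, x⟫ - φ x) +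
        t * (1 - t) * (σ / 2 * ‖x - u k‖ ^ 2)) atTop
        (𝓝 ((1 - t) * M + t * (⟪a, x⟫ - φ x) + t * (1 - t) * (σ / 2 * ‖x - p‖ ^ 2))) :=
      ((hua.const_mul _).add_const _).add
        ((((hup.const_sub x).norm.pow 2).const_mul _).const_mul _)
    have h := le_of_tendsto' hlim hk
    refine le_of_mul_le_mul_left ?_ ht
    linarith
  have hlim : Tendsto (fun t : ℝ => ⟪a, x⟫ - φ x + σ / 2 * (1 - t) * ‖x - p‖ ^ 2) (𝓝[>] 0)
      (𝓝 (⟪a, x⟫ - φ x + σ / 2 * (1 - 0) * ‖x - p‖ ^ 2)) :=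
    ((by fun_prop : Continuous fun t : ℝ =>
      ⟪a, x⟫ - φ x + σ / 2 * (1 - t) * ‖x - p‖ ^ 2).tendsto 0).mono_left nhdsWithin_le_nhds
  rw [sub_zero, mul_one] at hlim
  refine le_of_tendsto hlim ?_
  filter_upwards [Ioo_mem_nhdsGT (zero_lt_one' ℝ)] with t ht
  exact key t ht.1 ht.2

/-- The Bregman divergence of the conjugate dominates the squared distance between gradients. -/
theorem norm_sq_le_bregman_fenchelConjOn (hne : C.Nonempty) (hφ : StrongConvexOn C σ φ)
    (hσ : 0 < σ) {a b p q : EuclideanSpace ℝ (Fin n)}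
    (hp : HasGradientAt (fenchelConjOn C φ) p a) (hq : HasGradientAt (fenchelConjOn C φ) q b) :
    σ / 2 * ‖q - p‖ ^ 2 ≤ fenchelConjOn C φ a - fenchelConjOn C φ b - ⟪q, a - b⟫ := by
  obtain ⟨u, huC, huq, hub⟩ := exists_tendsto_fenchelConjOn hne hφ hσ hq
  have hk : ∀ k, ⟪b, u k⟫ - φ (u k) + ⟪u k, a - b⟫ + σ / 2 * ‖u k - p‖ ^ 2 ≤
      fenchelConjOn C φ a := by
    intro k
    have h := inner_sub_add_norm_sq_le_fenchelConjOn hφ hσ hp (huC k)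
    rw [inner_sub_right, real_inner_comm a, real_inner_comm b]
    linarith
  have hlim := (hub.add (huq.inner (tendsto_const_nhds (x := a - b)))).add
    (((huq.sub_const p).norm.pow 2).const_mul (σ / 2))
  have h := le_of_tendsto' hlim hk
  linarith

end FenchelConjugate

section Gradient

variable {E : Type*} [NormedAddCommGroup E] [InnerProductSpace ℝ E] [CompleteSpace E]
  {f : E → ℝ} {f' : E → E}

theorem HasGradientAt.hasDerivAt_add_smul (hf : ∀ x, HasGradientAt f (f' x) x) (x d : E) (t : ℝ) :
    HasDerivAt (fun t : ℝ => f (x + t • d)) ⟪f' (x + t • d), d⟫ t := by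
  have h1 : HasDerivAt (fun t : ℝ => x + t • d) d t := by
    simpa using ((hasDerivAt_id t).smul_const d).const_add x
  have h2 := (hf (x + t • d)).hasFDerivAt.comp_hasDerivAt t h1
  rwa [InnerProductSpace.toDual_apply_apply] at h2

theorem ConvexOn.add_inner_gradient_le (hconv : ConvexOn ℝ univ f)
    (hf : ∀ x, HasGradientAt f (f' x) x) (x y : E) : f x + ⟪f' x, y - x⟫ ≤ f y := by
  have hline : ConvexOn ℝ univ fun t : ℝ => f (x + t • (y - x)) := by
    have h := hconv.comp_affineMap (AffineMap.lineMap (k := ℝ) x y)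
    simpa [Function.comp_def, AffineMap.lineMap_apply, add_comm] using h
  have h := hline.le_slope_of_hasDerivAt (mem_univ 0) (mem_univ 1) one_pos
    (HasGradientAt.hasDerivAt_add_smul hf x (y - x) 0)
  simp [slope_def_field] at h
  linarith

/-- The descent lemma for functions with Lipschitz gradient. -/
theorem le_add_inner_gradient_add_norm_sq {L : ℝ} (hf : ∀ x, HasGradientAt f (f' x) x)
    (hL : ∀ x y, ‖f' x - f' y‖ ≤ L * ‖x - y‖) (x y : E) :
    f y ≤ f x + ⟪f' x, y - x⟫ + L / 2 * ‖y - x‖ ^ 2 := by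
  set d := y - x with hd
  have hder : ∀ t : ℝ, HasDerivAt
      (fun t : ℝ => f (x + t • d) - t * ⟪f' x, d⟫ - t ^ 2 * (L / 2 * ‖d‖ ^ 2))
      (⟪f' (x + t • d), d⟫ - ⟪f' x, d⟫ - 2 * t * (L / 2 * ‖d‖ ^ 2)) t := by
    intro t
    have h1 := (hasDerivAt_id t).mul_const ⟪f' x, d⟫
    have h2 := ((hasDerivAt_id t).pow 2).mul_const (L / 2 * ‖d‖ ^ 2)
    convert! ((HasGradientAt.hasDerivAt_add_smul hf x d t).sub h1).sub h2 using 1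
    simp
  have hanti := antitoneOn_of_deriv_nonpos (convex_Ici (0 : ℝ))
    (fun t _ => (hder t).continuousAt.continuousWithinAt)
    (fun t _ => (hder t).differentiableAt.differentiableWithinAt) (fun t ht => by
      rw [(hder t).deriv, ← inner_sub_left]
      have ht0 : 0 < t := by simpa using ht
      have h1 := real_inner_le_norm (f' (x + t • d) - f' x) d
      have h2 := hL (x + t • d) x
      rw [add_sub_cancel_left, norm_smul, Real.norm_of_nonneg ht0.le] at h2
      nlinarith [mul_le_mul_of_nonneg_right h2 (norm_nonneg d)])
  have h := hanti (mem_Ici.2 le_rfl) (mem_Ici.2 zero_le_one) zero_le_one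
  simp only [one_smul, zero_smul, add_zero, hd, add_sub_cancel] at h
  linarith

end Gradient

/-- A nonnegative sequence whose quadratically weighted sums are bounded has running minimum
`o(1/k³)`. -/
theorem tendsto_pow_three_mul_sInf_of_sum_le {a : ℕ → ℝ} (ha : ∀ i, 0 ≤ a i) {B : ℝ}
    (hB : ∀ k, ∑ i ∈ Finset.range k, ((i : ℝ) + 1) * ((i : ℝ) + 2) * a i ≤ B) :
    Tendsto (fun k : ℕ => (k : ℝ) ^ 3 * sInf (a '' {i : ℕ | i ≤ k})) atTop (𝓝 0) := by
  have hnn : ∀ i : ℕ, 0 ≤ ((i : ℝ) + 1) * ((i : ℝ) + 2) * a i := fun i =>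
    mul_nonneg (by positivity) (ha i)
  have hS := (summable_of_sum_range_le hnn hB).hasSum.tendsto_sum_nat
  have hdiff := (hS.comp (tendsto_add_atTop_nat 1)).sub
    (hS.comp (Nat.tendsto_div_const_atTop two_ne_zero))
  have hlim := hdiff.const_mul 8
  rw [sub_self, mul_zero] at hlim
  have hI : ∀ k : ℕ, 0 ≤ sInf (a '' {i : ℕ | i ≤ k}) := fun k =>
    Real.sInf_nonneg (by rintro _ ⟨i, -, rfl⟩; exact ha i)
  refine squeeze_zero (fun k => mul_nonneg (by positivity) (hI k)) (fun k => ?_) hlim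
  set m := sInf (a '' {i : ℕ | i ≤ k}) with hm
  have hle : ∀ i ≤ k, m ≤ a i := fun i hi =>
    csInf_le ⟨0, by rintro _ ⟨i, -, rfl⟩; exact ha i⟩ ⟨i, hi, rfl⟩
  simp only [Function.comp_apply]
  rw [← Finset.sum_Ico_eq_sub _ (by omega : k / 2 ≤ k + 1)]
  have hsum : ∑ _i ∈ Finset.Ico (k / 2) (k + 1), ((k : ℝ) / 2) ^ 2 * m ≤
      ∑ i ∈ Finset.Ico (k / 2) (k + 1), ((i : ℝ) + 1) * ((i : ℝ) + 2) * a i := by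
    refine Finset.sum_le_sum fun i hi => ?_
    rw [Finset.mem_Ico] at hi
    have hki : (k : ℝ) ≤ 2 * i + 1 := by exact_mod_cast (by omega : k ≤ 2 * i + 1)
    have hk0 : (0 : ℝ) ≤ k := k.cast_nonneg
    refine mul_le_mul ?_ (hle i (by omega)) (hI k) (by positivity)
    nlinarith
  rw [Finset.sum_const, Nat.card_Ico, nsmul_eq_mul] at hsum
  have hcard : (k : ℝ) / 2 ≤ ((k + 1 - k / 2 : ℕ) : ℝ) := by
    have : (k : ℝ) ≤ 2 * ((k + 1 - k / 2 : ℕ) : ℝ) := by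
      exact_mod_cast (by omega : k ≤ 2 * (k + 1 - k / 2))
    linarith
  have h := mul_le_mul_of_nonneg_right hcard (mul_nonneg (sq_nonneg ((k : ℝ) / 2)) (hI k))
  rw [← hm] at h
  nlinarith

/-- One step of the accelerated scheme: the estimates for the gradient step and the mirror step
combine into a decrease of the Lyapunov function. -/
theorem lyapunov_decrease {k σ s c F₀ F₁ G W d D₀ D₁ : ℝ} (hk : 0 ≤ k) (hσ : 0 < σ) (hs : 0 < s)
    (hW : 0 ≤ W)
    (hgrad : F₁ ≤ k / (k + 2) * F₀ + 2 / (k + 2) * G +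
      1 / (2 * s) * ((2 / (k + 2)) ^ 2 * W) - c * d)
    (hmirror : (k + 1) * σ * s / 2 * G ≤ D₀ - D₁ - σ / 2 * W) :
    (k + 1) * (k + 2) * F₁ + 4 / (σ * s) * D₁ + c * ((k + 1) * (k + 2) * d) ≤
      k * (k + 1) * F₀ + 4 / (σ * s) * D₀ := by
  have h1 := mul_le_mul_of_nonneg_left hgrad (by positivity : 0 ≤ (k + 1) * (k + 2))
  have h2 := mul_le_mul_of_nonneg_left hmirror (by positivity : 0 ≤ 4 / (σ * s))
  have e1 : (k + 1) * (k + 2) * (k / (k + 2) * F₀ + 2 / (k + 2) * G +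
      1 / (2 * s) * ((2 / (k + 2)) ^ 2 * W) - c * d) = k * (k + 1) * F₀ + 2 * (k + 1) * G +
      (2 * W / s) * ((k + 1) / (k + 2)) - c * ((k + 1) * (k + 2) * d) := by
    field_simp
  have e2 : 4 / (σ * s) * ((k + 1) * σ * s / 2 * G) = 2 * (k + 1) * G := by
    field_simp
    ring
  have e3 : 4 / (σ * s) * (D₀ - D₁ - σ / 2 * W) =
      4 / (σ * s) * D₀ - 4 / (σ * s) * D₁ - 2 * W / s := by
    field_simp
    ring
  have h3 : (2 * W / s) * ((k + 1) / (k + 2)) ≤ 2 * W / s :=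
    mul_le_of_le_one_right (by positivity) ((div_le_one (by positivity)).2 (by linarith))
  linarith

/-- For Nesterov's accelerated mirror descent with `0 < s < 1/L`,
`min_{0 ≤ i ≤ k} ‖y_{i+1} − x_i‖² = o(1/k³)` as `k → ∞`. -/
theorem nesterov_mirror_descent_displacement_rate
{n : ℕ} (C : Set (EuclideanSpace ℝ (Fin n)))
    (hCconv : Convex ℝ C) (hCclosed : IsClosed C) (hCne : C.Nonempty)
    (f φ : EuclideanSpace ℝ (Fin n) → ℝ)
    (f' gφs : EuclideanSpace ℝ (Fin n) → EuclideanSpace ℝ (Fin n))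
    (σ L s : ℝ) (hσ : 0 < σ)
    -- f is convex and differentiable with L-Lipschitz gradient
    (hfconv : ConvexOn ℝ Set.univ f)
    (hfd : ∀ x, HasGradientAt f (f' x) x)
    (hfL : ∀ x y, ‖f' x - f' y‖ ≤ L * ‖x - y‖)
    -- φ is σ-strongly convex on C
    (hφsc : StrongConvexOn C σ φ)
    -- φ* is differentiable with gradient gφs, taking values in C
    (hgφs : ∀ z, HasGradientAt (fenchelConjOn C φ) (gφs z) z)
    (hgφsC : ∀ z, gφs z ∈ C)
    -- Nesterov's accelerated mirror descent iteration
    (x y z : ℕ → EuclideanSpace ℝ (Fin n))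
    (hz : ∀ k : ℕ, z (k + 1) = z k - ((((k : ℝ) + 1) * σ * s) / 2) • f' (x k))
    (hy : ∀ k : ℕ, y (k + 1) ∈ C ∧ ∀ w ∈ C,
      s * ⟪f' (x k), y (k + 1)⟫ + (1 / 2) * ‖y (k + 1) - x k‖ ^ 2 ≤
        s * ⟪f' (x k), w⟫ + (1 / 2) * ‖w - x k‖ ^ 2)
    (hx : ∀ k : ℕ, x (k + 1) =
      ((((k : ℝ) + 1)) / ((k : ℝ) + 3)) • y (k + 1) + (2 / ((k : ℝ) + 3)) • gφs (z (k + 1)))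
    (hx0 : x 0 = gφs (z 0)) (hy0 : y 0 = x 0)
    -- x* is a minimizer of f over C and ∇φ*(z*) = x*
    (xs zs : EuclideanSpace ℝ (Fin n))
    (hxsC : xs ∈ C) (hxs : ∀ w ∈ C, f xs ≤ f w) (hzs : gφs zs = xs)
    (hs : 0 < s) (hsL : s < 1 / L) :
    Tendsto
      (fun k : ℕ => (k : ℝ) ^ 3 * sInf ((fun i => ‖y (i + 1) - x i‖ ^ 2) '' {i : ℕ | i ≤ k}))
      atTop (𝓝 0) := by
  set D : ℕ → ℝ := fun k =>
    fenchelConjOn C φ (z k) - fenchelConjOn C φ zs - ⟪xs, z k - zs⟫ with hD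
  have hD0 : ∀ k, 0 ≤ D k := fun k =>
    le_trans (by positivity)
      (norm_sq_le_bregman_fenchelConjOn hCne hφsc hσ (hgφs (z k)) (hzs ▸ hgφs zs))
  have hyC : ∀ k, y k ∈ C := by
    rintro (_ | k)
    · rw [hy0, hx0]
      exact hgφsC _
    · exact (hy k).1
  have hxk : ∀ k : ℕ, x k =
      ((k : ℝ) / ((k : ℝ) + 2)) • y k + (2 / ((k : ℝ) + 2)) • gφs (z k) := by
    rintro (_ | k)
    · simp [hx0]
    · rw [hx k]
      push_cast
      ring_nf
  have hL : 0 < L := one_div_pos.1 (hs.trans hsL)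
  have hsL' : s * L < 1 := (lt_div_iff₀ hL).1 hsL
  set c := (1 - s * L) / (2 * s) with hc
  have hc0 : 0 < c := div_pos (by linarith) (by linarith)
  have hstep : ∀ k : ℕ,
      ((k : ℝ) + 1) * ((k : ℝ) + 2) * (f (y (k + 1)) - f xs) + 4 / (σ * s) * D (k + 1) +
        c * (((k : ℝ) + 1) * ((k : ℝ) + 2) * ‖y (k + 1) - x k‖ ^ 2) ≤
      (k : ℝ) * ((k : ℝ) + 1) * (f (y k) - f xs) + 4 / (σ * s) * D k := by
    intro k
    refine lyapunov_decrease (G := ⟪f' (x k), gφs (z (k + 1)) - xs⟫)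
      (W := ‖gφs (z (k + 1)) - gφs (z k)‖ ^ 2) k.cast_nonneg hσ hs (by positivity) ?_ ?_
    · have hk2 : (0 : ℝ) < (k : ℝ) + 2 := by positivity
      set α := (k : ℝ) / ((k : ℝ) + 2) with hα
      set β := 2 / ((k : ℝ) + 2) with hβ
      have hα0 : 0 ≤ α := by positivity
      have hβ0 : 0 ≤ β := by positivity
      have hαβ : α + β = 1 := by rw [hα, hβ]; field_simp
      have hprox := (hy k).2 _ (hCconv (hyC k) (hgφsC (z (k + 1))) hα0 hβ0 hαβ)
      have hdesc := le_add_inner_gradient_add_norm_sq hfd hfL (x k) (y (k + 1))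
      have hc1 := hfconv.add_inner_gradient_le hfd (x k) (y k)
      have hc2 := hfconv.add_inner_gradient_le hfd (x k) xs
      have hux : α • y k + β • gφs (z (k + 1)) - x k =
          β • (gφs (z (k + 1)) - gφs (z k)) := by
        rw [hxk k, smul_sub]
        abel
      rw [hux, norm_smul, mul_pow, Real.norm_of_nonneg hβ0] at hprox
      simp only [inner_add_right, inner_sub_right, real_inner_smul_right] at hprox hdesc hc1 hc2 ⊢
      have hprox' := mul_le_mul_of_nonneg_left hprox (by positivity : 0 ≤ 1 / s)
      have e1 : ∀ A Q : ℝ, 1 / s * (s * A + 1 / 2 * Q) = A + 1 / (2 * s) * Q := by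
        intro A Q
        field_simp
      rw [e1, e1] at hprox'
      have e2 : ∀ Q : ℝ, c * Q = 1 / (2 * s) * Q - L / 2 * Q := by
        intro Q
        rw [hc]
        field_simp
      rw [e2]
      have hc1' := mul_le_mul_of_nonneg_left hc1 hα0
      have hc2' := mul_le_mul_of_nonneg_left hc2 hβ0
      have hsplit : ∀ r : ℝ, α * r + β * r = r := fun r => by rw [← add_mul, hαβ, one_mul]
      linarith [hsplit (f (x k)), hsplit (f xs), hsplit ⟪f' (x k), x k⟫]
    · have hb := norm_sq_le_bregman_fenchelConjOn hCne hφsc hσ (hgφs (z k)) (hgφs (z (k + 1)))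
      have hzz : z k - z (k + 1) = (((k : ℝ) + 1) * σ * s / 2) • f' (x k) := by
        rw [hz k]
        abel
      have e : ((k : ℝ) + 1) * σ * s / 2 * ⟪f' (x k), gφs (z (k + 1)) - xs⟫ =
          ⟪gφs (z (k + 1)), z k - z (k + 1)⟫ - ⟪xs, z k - z (k + 1)⟫ := by
        rw [← inner_sub_left, hzz, real_inner_smul_right, real_inner_comm]
      rw [e]
      simp only [hD, inner_sub_right] at hb ⊢
      linarith
  have hsum : ∀ k : ℕ,
      (k : ℝ) * ((k : ℝ) + 1) * (f (y k) - f xs) + 4 / (σ * s) * D k +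
        c * ∑ i ∈ Finset.range k, ((i : ℝ) + 1) * ((i : ℝ) + 2) * ‖y (i + 1) - x i‖ ^ 2 ≤
      4 / (σ * s) * D 0 := by
    intro k
    induction k with
    | zero => simp
    | succ k ih =>
      rw [Finset.sum_range_succ]
      push_cast
      linarith [hstep k]
  refine tendsto_pow_three_mul_sInf_of_sum_le (a := fun i => ‖y (i + 1) - x i‖ ^ 2)
    (fun i => by positivity) (B := 4 / (σ * s) * D 0 / c) fun k => ?_
  rw [le_div_iff₀' hc0]
  have h1 : 0 ≤ (k : ℝ) * ((k : ℝ) + 1) * (f (y k) - f xs) :=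
    mul_nonneg (by positivity) (sub_nonneg.2 (hxs _ (hyC k)))
  have h2 : 0 ≤ 4 / (σ * s) * D k := mul_nonneg (by positivity) (hD0 k)
  linarith [hsum k]
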